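/- In R = MvPolynomial (Fin 8) ℤ, the second elementary symmetric function of the multiset W((2,1,1,1,1,1,1), 8) of weights of semistandard Young tableaux of shape (2,1,1,1,1,1,1) with entries in {0,…,7} is congruent to 16·e₂ modulo the ideal generated by e₁; equivalently, c₂(γ₈^{(2,1,1,1,1,1,1)}) = 16·c₂(γ₈), the Table 1 entry for the weight α₁+α₇ of SL₈/μ₂ (this representation is the adjoint representation of SL₈, consistent with c₂(Ad) = 2n·c₂ for n = 8). -/

import Mathlib

open MvPolynomial

open scoped Classical in
/-- The multiset `W(lam, n)` of weights of semistandard Young tableaux of shape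
`lam` (a list of row lengths) with entries in `{0, …, n-1}`: a tableau assigns
to each cell `(i, j)` of the Young diagram of `lam` an entry in `Fin n`, weakly
increasing along rows and strictly increasing down columns; its weight is the
sum `∑_{(i,j) ∈ lam} X_{T(i,j)}`. -/
noncomputable def ssytWeights (lam : List ℕ) (n : ℕ) :
    Multiset (MvPolynomial (Fin n) ℤ) :=
  ((Finset.univ : Finset ((i : Fin lam.length) → Fin (lam.get i) → Fin n)).filter
      (fun T =>
        (∀ (i : Fin lam.length) (j j' : Fin (lam.get i)), (j : ℕ) ≤ (j' : ℕ) → T i j ≤ T i j') ∧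
        (∀ (i i' : Fin lam.length), (i : ℕ) < (i' : ℕ) →
          ∀ (j : Fin (lam.get i')) (hj : (j : ℕ) < lam.get i), T i ⟨j, hj⟩ < T i' j))).val.map
    (fun T => ∑ i, ∑ j, MvPolynomial.X (T i j))

/-- Newton's identity expressing twice the second elementary symmetric function of a multiset
through its sum and its sum of squares. -/
theorem Multiset.two_mul_esymm_two {R : Type*} [CommRing R] (s : Multiset R) :
    2 * s.esymm 2 = s.sum ^ 2 - (s.map (· ^ 2)).sum := by
  induction s using Multiset.induction_on with
  | empty => simp [Multiset.esymm, Multiset.powersetCard_zero_right]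
  | cons a s ih =>
    have h : (a ::ₘ s).esymm 2 = s.esymm 2 + a * s.sum := by
      have ha : (s.map (a * ·)).sum = a * s.sum := by
        simpa using Multiset.sum_map_mul_left (s := s) (a := a) (f := id)
      simp [Multiset.esymm, Multiset.powersetCard_cons, Multiset.powersetCard_one, ha]
    rw [h, mul_add, ih, Multiset.sum_cons, Multiset.map_cons, Multiset.sum_cons]
    ring

/-- A strictly increasing map `Fin n → Fin (n + 1)` skips exactly one value. -/
theorem Fin.exists_eq_succAbove_of_strictMono {n : ℕ} {f : Fin n → Fin (n + 1)}
    (hf : StrictMono f) : ∃ m : Fin (n + 1), f = m.succAbove := by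
  have hns : ¬ Function.Surjective f := fun h => by
    simpa using Fintype.card_le_of_surjective f h
  obtain ⟨m, hm⟩ := not_forall.1 hns
  refine ⟨m, (hf.range_inj m.strictMono_succAbove).1 ?_⟩
  have hsub : Finset.univ.image f ⊆ Finset.univ.image m.succAbove := by
    intro x hx
    obtain ⟨k, rfl⟩ : ∃ k, f k = x := by simpa using hx
    obtain ⟨l, hl⟩ := Fin.exists_succAbove_eq (x := f k) (y := m) (fun h => hm ⟨k, h⟩)
    exact Finset.mem_image.2 ⟨l, Finset.mem_univ _, hl⟩
  have heq := Finset.eq_of_subset_of_card_le hsub (by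
    rw [Finset.card_image_of_injective _ hf.injective,
      Finset.card_image_of_injective _ m.succAbove_right_injective])
  simpa using congrArg (fun s : Finset (Fin (n + 1)) => (s : Set (Fin (n + 1)))) heq

/-- The filling of the shape `[2, 1, 1, 1, 1, 1, 1]` whose first column omits exactly the entry
`p.1` and whose cell outside the first column has entry `p.2`. -/
def adjointTableau (p : Fin 8 × Fin 8) (i : Fin [2, 1, 1, 1, 1, 1, 1].length)
    (j : Fin ([2, 1, 1, 1, 1, 1, 1].get i)) : Fin 8 :=
  if (j : ℕ) = 0 then p.1.succAbove i else p.2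

theorem get_adjoint_shape_pos (i : Fin [2, 1, 1, 1, 1, 1, 1].length) :
    0 < [2, 1, 1, 1, 1, 1, 1].get i := by
  revert i; decide

theorem get_adjoint_shape_le_one (i : Fin [2, 1, 1, 1, 1, 1, 1].length) (hi : 0 < (i : ℕ)) :
    [2, 1, 1, 1, 1, 1, 1].get i ≤ 1 := by
  revert i; decide

theorem eq_zero_of_adjoint_shape {i : Fin [2, 1, 1, 1, 1, 1, 1].length}
    (j : Fin ([2, 1, 1, 1, 1, 1, 1].get i)) (hj : (j : ℕ) ≠ 0) : i = (0 : Fin 7) := by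
  have h : ∀ i : Fin [2, 1, 1, 1, 1, 1, 1].length,
      1 < [2, 1, 1, 1, 1, 1, 1].get i → i = (0 : Fin 7) := by decide
  exact h i (lt_of_le_of_lt (Nat.one_le_iff_ne_zero.2 hj) j.2)

theorem sum_adjointTableau (p : Fin 8 × Fin 8) :
    ∑ i, ∑ j, (X (adjointTableau p i j) : MvPolynomial (Fin 8) ℤ) =
      ∑ k, X k - X p.1 + X p.2 := by
  have h : ∑ i, ∑ j, (X (adjointTableau p i j) : MvPolynomial (Fin 8) ℤ) =
      ∑ i : Fin 7, X (p.1.succAbove i) + X p.2 := by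
    change ∑ i : Fin 7, ∑ j : Fin ([2, 1, 1, 1, 1, 1, 1].get i), X (adjointTableau p i j) = _
    rw [Fin.sum_univ_succ, Fin.sum_univ_succ (n := 6)]
    have h0 : ∑ j : Fin ([2, 1, 1, 1, 1, 1, 1].get (0 : Fin 7)),
        (X (adjointTableau p (0 : Fin 7) j) : MvPolynomial (Fin 8) ℤ) =
          X (p.1.succAbove 0) + X p.2 :=
      Fin.sum_univ_two (fun j : Fin 2 => X (adjointTableau p (0 : Fin 7) j))
    have hs : ∀ i : Fin 6, ∑ j : Fin ([2, 1, 1, 1, 1, 1, 1].get i.succ),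
        (X (adjointTableau p i.succ j) : MvPolynomial (Fin 8) ℤ) = X (p.1.succAbove i.succ) := by
      intro i
      rw [Finset.sum_eq_single_of_mem ⟨0, get_adjoint_shape_pos i.succ⟩ (Finset.mem_univ _)]
      · rfl
      · intro j _ hj
        have := get_adjoint_shape_le_one i.succ (by simp)
        exact absurd (Fin.ext (by have := j.2; simp only; omega)) hj
    rw [h0, Finset.sum_congr rfl fun i _ => hs i]
    ring
  rw [h, Fin.sum_univ_succAbove _ p.1]
  ring

theorem succAbove_zero_le_iff (p : Fin 8 × Fin 8) :
    p.1.succAbove (0 : Fin 7) ≤ p.2 ↔ p ≠ (0, 0) := by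
  revert p; decide

set_option linter.constructorNameAsVariable false in
/-- The semistandard tableaux of shape `[2, 1, 1, 1, 1, 1, 1]` with entries in `{0, …, 7}` are
indexed by the pairs `(m, b) ≠ (0, 0)`, the weight of the corresponding tableau being
`e₁ - X_m + X_b`. -/
theorem sum_map_ssytWeights_adjoint (f : MvPolynomial (Fin 8) ℤ → MvPolynomial (Fin 8) ℤ) :
    ((ssytWeights [2, 1, 1, 1, 1, 1, 1] 8).map f).sum =
      ∑ p ∈ Finset.univ.erase ((0, 0) : Fin 8 × Fin 8), f (∑ k, X k - X p.1 + X p.2) := by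
  classical
  rw [ssytWeights, Multiset.map_map]
  refine (Finset.sum_nbij adjointTableau ?_ ?_ ?_ ?_).symm
  · intro p hp
    have hp' := (succAbove_zero_le_iff p).2 (Finset.ne_of_mem_erase hp)
    rw [Finset.mem_filter_univ]
    refine ⟨?_, ?_⟩
    · intro i j j' hjj
      by_cases hj' : (j' : ℕ) = 0
      · have hj : (j : ℕ) = 0 := by omega
        simp [adjointTableau, hj, hj']
      by_cases hj : (j : ℕ) = 0
      · obtain rfl := eq_zero_of_adjoint_shape j' hj'
        simpa only [adjointTableau, hj, hj', if_true, if_false] using hp'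
      · simp [adjointTableau, hj, hj']
    · intro i i' hi j hj
      have := get_adjoint_shape_le_one i' (by omega)
      have hj0 : (j : ℕ) = 0 := by have := j.2; omega
      simp only [adjointTableau, hj0, if_true]
      exact p.1.strictMono_succAbove hi
  · intro p _ q _ h
    refine Prod.ext (Fin.succAbove_left_injective (funext fun i : Fin 7 => ?_)) ?_
    · exact congrFun (congrFun h i) ⟨0, get_adjoint_shape_pos i⟩
    · exact congrFun (congrFun h (0 : Fin 7)) (1 : Fin 2)
  · intro T hT
    rw [Finset.mem_coe, Finset.mem_filter_univ] at hT
    obtain ⟨hrow, hcol⟩ := hT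
    obtain ⟨m, hm⟩ := Fin.exists_eq_succAbove_of_strictMono
      (f := fun i : Fin 7 => T i ⟨0, get_adjoint_shape_pos i⟩)
      (fun i i' hi => hcol i i' hi ⟨0, get_adjoint_shape_pos i'⟩ (get_adjoint_shape_pos i))
    have hrow0 : T (0 : Fin 7) (0 : Fin 2) ≤ T (0 : Fin 7) (1 : Fin 2) :=
      hrow (0 : Fin 7) (0 : Fin 2) (1 : Fin 2) (Nat.zero_le _)
    have hm0 : T (0 : Fin 7) (0 : Fin 2) = m.succAbove 0 := congrFun hm 0
    refine ⟨(m, T (0 : Fin 7) (1 : Fin 2)), ?_, ?_⟩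
    · refine Finset.mem_coe.2 (Finset.mem_erase.2 ⟨?_, Finset.mem_univ _⟩)
      exact (succAbove_zero_le_iff _).1 (hm0 ▸ hrow0)
    · funext i j
      by_cases hj : (j : ℕ) = 0
      · obtain rfl : j = ⟨0, get_adjoint_shape_pos i⟩ := Fin.ext hj
        exact (congrFun hm i).symm
      · obtain rfl := eq_zero_of_adjoint_shape j hj
        obtain rfl : j = (1 : Fin 2) := Fin.ext (by
          have : (j : ℕ) < 2 := j.2
          change (j : ℕ) = 1
          omega)
        rfl
  · intro p _
    exact congrArg f (sum_adjointTableau p).symm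

/-- `c₂(γ8^[2, 1, 1, 1, 1, 1, 1]) = 16·c₂(γ8)`: the second elementary symmetric function of
the multiset of weights of semistandard Young tableaux of shape `[2, 1, 1, 1, 1, 1, 1]` with
entries in `{0, …, 7}` is congruent to `16·e₂` modulo the ideal generated
by `e₁`. -/
theorem c2_ssyt_stmt9 :
    Multiset.esymm (ssytWeights [2, 1, 1, 1, 1, 1, 1] 8) 2 - 16 * esymm (Fin 8) ℤ 2
      ∈ Ideal.span {esymm (Fin 8) ℤ 1} := by
  have hW := Multiset.two_mul_esymm_two (ssytWeights [2, 1, 1, 1, 1, 1, 1] 8)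
  have he := Multiset.two_mul_esymm_two
    (Finset.univ.val.map (X : Fin 8 → MvPolynomial (Fin 8) ℤ))
  rw [← MvPolynomial.esymm_eq_multiset_esymm, Multiset.map_map] at he
  change _ = (∑ k, X k) ^ 2 - ∑ k, X k ^ 2 at he
  have h1 := sum_map_ssytWeights_adjoint id
  have h2 := sum_map_ssytWeights_adjoint (· ^ 2)
  rw [Multiset.map_id] at h1
  rw [h1, h2, Finset.sum_erase_eq_sub (Finset.mem_univ _),
    Finset.sum_erase_eq_sub (Finset.mem_univ _)] at hW
  rw [Ideal.mem_span_singleton, esymm_one]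
  refine ⟨1946 * ∑ k, X k, mul_left_cancel₀ (two_ne_zero (α := MvPolynomial (Fin 8) ℤ)) ?_⟩
  rw [mul_sub, hW, mul_left_comm, he]
  simp only [Fintype.sum_prod_type, Fin.sum_univ_eight, id]
  ring
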